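/- Let G be a tree on [n] with edge ideal I. Then for every k > 0, either index(I^k) = 1 or index(I^k) = infinity; more precisely, if index(I) = infinity then index(I^k) = infinity for all k > 0, and if index(I) = 1 then index(I^k) = 1 for all k > 0; no intermediate finite values of index(I) > 1 can occur for a tree. -/

import Mathlib

open MvPolynomial

noncomputable section

abbrev SRing (K : Type) [Field K] (n : ℕ) := MvPolynomial (Fin n) K

/-- total degree of an exponent vector -/
def mdeg {n : ℕ} (e : Fin n →₀ ℕ) : ℕ := e.sum fun _ v => v

/-- minimal monomial generators of a monomial ideal, as exponent vectors:
monomials in `J` none of whose proper divisors lies in `J` -/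
def minGen {K : Type} [Field K] {n : ℕ} (J : Ideal (SRing K n)) : Set (Fin n →₀ ℕ) :=
  {e | (monomial e (1:K)) ∈ J ∧
    ∀ e' : Fin n →₀ ℕ, e' ≤ e → e' ≠ e → (monomial e' (1:K)) ∉ J}

/-- adjacency in the graph `G_J^{(u,v)}` : vertices are the minimal generators of `J`
dividing `lcm(u,v)`, with an edge between two of them iff their lcm has degree `d+1` -/
def lcmGraphAdj {K : Type} [Field K] {n : ℕ} (J : Ideal (SRing K n)) (d : ℕ)
    (u v : Fin n →₀ ℕ) (w w' : Fin n →₀ ℕ) : Prop :=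
  w ∈ minGen J ∧ w' ∈ minGen J ∧ w ≤ u ⊔ v ∧ w' ≤ u ⊔ v ∧ mdeg (w ⊔ w') = d + 1

/-- a graded partial free resolution of the ideal `I`, exact at homological positions `< r`:
`F_i` is free with basis in (internal) degrees `dg i`, the maps are graded of degree `0`,
`F_0` surjects onto `I`, and the sequence is exact at `F_i` for `i < r`. -/
structure GradedPartialRes {K : Type} [Field K] {n : ℕ} (I : Ideal (SRing K n)) (r : ℕ∞) where
  s : ℕ → ℕ
  dg : ∀ i, Fin (s i) → ℕ
  aug : (Fin (s 0) →₀ SRing K n) →ₗ[SRing K n] SRing K n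
  diff : ∀ i, (Fin (s (i+1)) →₀ SRing K n) →ₗ[SRing K n] (Fin (s i) →₀ SRing K n)
  aug_hom : ∀ k, (aug (Finsupp.single k 1)).IsHomogeneous (dg 0 k)
  diff_hom : ∀ i k l, (diff i (Finsupp.single k 1)) l = 0 ∨
      ∃ m, ((diff i (Finsupp.single k 1)) l).IsHomogeneous m ∧ dg i l + m = dg (i+1) k
  aug_range : LinearMap.range aug = I
  exact_zero : (0 : ℕ∞) < r → LinearMap.range (diff 0) = LinearMap.ker aug
  exact_succ : ∀ i : ℕ, ((i : ℕ∞) + 1) < r →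
      LinearMap.range (diff (i+1)) = LinearMap.ker (diff i)

/-- the graded Betti number `β_{i,j}(I)`: the minimal number of degree-`j` basis elements
in homological position `i`, over all graded partial resolutions of `I` exact at
positions `0, …, i` (the minimum is attained by the minimal graded free resolution). -/
def gradedBetti {K : Type} [Field K] {n : ℕ} (I : Ideal (SRing K n)) (i j : ℕ) : ℕ∞ :=
  ⨅ R : GradedPartialRes I ((i : ℕ∞)+1),
    ((Finset.univ.filter fun k => R.dg i k = j).card : ℕ∞)

/-- `I` (generated in degree `d`) is `r` steps linear: `β_{i,i+j}(I) = 0` for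
all `i ≤ r` and `j > d` -/
def stepsLinear {K : Type} [Field K] {n : ℕ} (I : Ideal (SRing K n)) (d r : ℕ) : Prop :=
  ∀ i ≤ r, ∀ j, d < j → gradedBetti I i (i+j) = 0

/-- `index(I) = sup{r : I is r steps linear} + 1` -/
def idealIndex {K : Type} [Field K] {n : ℕ} (I : Ideal (SRing K n)) (d : ℕ) : ℕ∞ :=
  sSup {x : ℕ∞ | ∃ r : ℕ, x = (r : ℕ∞) + 1 ∧ stepsLinear I d r}

/-- `I` is linearly related: all first syzygies are linear, i.e. `index(I) > 1` -/
def LinearlyRelated {K : Type} [Field K] {n : ℕ} (I : Ideal (SRing K n)) (d : ℕ) : Prop :=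
  stepsLinear I d 1

/-- projective dimension of `I`: the minimal length of a graded free resolution of `I` -/
def projDim {K : Type} [Field K] {n : ℕ} (I : Ideal (SRing K n)) : ℕ∞ :=
  sInf {x : ℕ∞ | ∃ m : ℕ, x = (m : ℕ∞) ∧
    ∃ R : GradedPartialRes I ⊤, ∀ i : ℕ, m < i → R.s i = 0}

/-- the edge ideal of the graph (possibly with loops) given by a symmetric relation `E`:
generated by the monomials `X i * X j` with `E i j` -/
def edgeIdeal (K : Type) [Field K] {n : ℕ} (E : Fin n → Fin n → Prop) : Ideal (SRing K n) :=
  Ideal.span {p | ∃ i j, E i j ∧ p = X i * X j}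

/-- `E` is gap free: for any two disjoint edges there is an edge meeting both -/
def GapFree {n : ℕ} (E : Fin n → Fin n → Prop) : Prop :=
  ∀ i i' j j', E i i' → E j j' → i ≠ j → i ≠ j' → i' ≠ j → i' ≠ j' →
    ∃ a b, E a b ∧ (a = i ∨ a = i') ∧ (b = j ∨ b = j')

/-- The vectors of a free module all of whose coordinates are homogeneous of degree `e`. -/
def homVec (K : Type) [Field K] (n t e : ℕ) : AddSubgroup (Fin t →₀ SRing K n) where
  carrier := {w | ∀ l, (w l).IsHomogeneous e}
  add_mem' ha hb l := (ha l).add (hb l)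
  zero_mem' _ := isHomogeneous_zero _ _ _
  neg_mem' ha l := (homogeneousSubmodule (Fin n) K e).neg_mem (ha l)

/-- `LinearUpTo r M 𝓜`: the module `M`, whose piece of degree `d + e` is `𝓜 e`, is generated in
degree `d` and has the first `r` steps of a `d`-linear free resolution. -/
def LinearUpTo {K : Type} [Field K] {n : ℕ} :
    ℕ → ∀ (M : Type) [AddCommGroup M] [Module (SRing K n) M], (ℕ → AddSubgroup M) → Prop
  | 0, _, _, _, _ => True
  | r + 1, M, _, _, 𝓜 => ∃ (t : ℕ) (φ : (Fin t →₀ SRing K n) →ₗ[SRing K n] M),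
      Function.Surjective φ ∧ (∀ e, ∀ w ∈ homVec K n t e, φ w ∈ 𝓜 e) ∧
      (∀ e, ∀ m ∈ 𝓜 e, ∃ w ∈ homVec K n t e, φ w = m) ∧
      LinearUpTo (K := K) (n := n) r (LinearMap.ker φ)
        (fun e => (homVec K n t (e + 1)).comap (LinearMap.ker φ).subtype.toAddMonoidHom)

section Linear

variable {K : Type} [Field K] {n : ℕ}

lemma mem_homVec {t e : ℕ} {w : Fin t →₀ SRing K n} :
    w ∈ homVec K n t e ↔ ∀ l, (w l).IsHomogeneous e := Iff.rfl

lemma single_mem_homVec (t : ℕ) (l : Fin t) :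
    (Finsupp.single l 1 : Fin t →₀ SRing K n) ∈ homVec K n t 0 := by
  intro i
  rw [Finsupp.single_apply]
  split_ifs
  · exact isHomogeneous_one _ _
  · exact isHomogeneous_zero _ _ _

lemma smul_mem_homVec {t e d : ℕ} {w : Fin t →₀ SRing K n} (hw : w ∈ homVec K n t e)
    {s : SRing K n} (hs : s.IsHomogeneous d) : s • w ∈ homVec K n t (e + d) := by
  intro l
  rw [Finsupp.smul_apply, smul_eq_mul, add_comm]
  exact hs.mul (hw l)

lemma apply_eq_sum {t : ℕ} {M : Type} [AddCommGroup M] [Module (SRing K n) M]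
    (φ : (Fin t →₀ SRing K n) →ₗ[SRing K n] M) (w : Fin t →₀ SRing K n) :
    φ w = ∑ l, w l • φ (Finsupp.single l 1) := by
  conv_lhs => rw [show w = ∑ l, w l • Finsupp.single l (1 : SRing K n) by ext1 i; simp]
  simp only [map_sum, map_smul]

lemma map_mem_of_mem_homVec {M : Type} [AddCommGroup M] [Module (SRing K n) M]
    {𝓜 : ℕ → AddSubgroup M}
    (hM : ∀ e d, ∀ m ∈ 𝓜 e, ∀ s : SRing K n, s.IsHomogeneous d → s • m ∈ 𝓜 (e + d))
    {t : ℕ} (φ : (Fin t →₀ SRing K n) →ₗ[SRing K n] M)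
    (hφ : ∀ l, φ (Finsupp.single l 1) ∈ 𝓜 0) {e : ℕ} {w : Fin t →₀ SRing K n}
    (hw : w ∈ homVec K n t e) : φ w ∈ 𝓜 e := by
  rw [apply_eq_sum φ]
  refine sum_mem fun l _ => ?_
  simpa using hM 0 e _ (hφ l) _ (hw l)

/-- Splitting a free module into two free summands, compatibly with homogeneity. -/
lemma exists_equiv_prod_homVec (a b : ℕ) :
    ∃ ε : (Fin (a + b) →₀ SRing K n) ≃ₗ[SRing K n]
      (Fin a →₀ SRing K n) × (Fin b →₀ SRing K n),
      ∀ e w, w ∈ homVec K n (a + b) e ↔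
        (ε w).1 ∈ homVec K n a e ∧ (ε w).2 ∈ homVec K n b e := by
  refine ⟨(Finsupp.domLCongr finSumFinEquiv.symm).trans
    (Finsupp.sumFinsuppLEquivProdFinsupp (SRing K n)), fun e w => ?_⟩
  simp only [mem_homVec]
  constructor
  · intro h
    exact ⟨fun l => by simpa using h _, fun l => by simpa using h _⟩
  · rintro ⟨h1, h2⟩ l
    obtain ⟨l, rfl⟩ := finSumFinEquiv.surjective l
    rcases l with l | l
    · simpa using h1 l
    · simpa using h2 l

lemma linearUpTo_of_subsingleton (r : ℕ) (M : Type) [AddCommGroup M] [Module (SRing K n) M]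
    [Subsingleton M] (𝓜 : ℕ → AddSubgroup M) : LinearUpTo (K := K) (n := n) r M 𝓜 := by
  induction r generalizing M with
  | zero => trivial
  | succ r ih =>
    refine ⟨0, 0, fun m => ⟨0, Subsingleton.elim _ _⟩, fun e w _ => ?_, fun e m _ =>
      ⟨0, zero_mem _, Subsingleton.elim _ _⟩, ih _ _⟩
    rw [Subsingleton.elim ((0 : (Fin 0 →₀ SRing K n) →ₗ[SRing K n] M) w) 0]
    exact zero_mem _

/-- The class of modules with a linear resolution is closed under extensions. -/
lemma LinearUpTo.extension (r : ℕ) {N M P : Type} [AddCommGroup N] [Module (SRing K n) N]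
    [AddCommGroup M] [Module (SRing K n) M] [AddCommGroup P] [Module (SRing K n) P]
    {𝓝 : ℕ → AddSubgroup N} {𝓜 : ℕ → AddSubgroup M} {𝓟 : ℕ → AddSubgroup P}
    (i : N →ₗ[SRing K n] M) (p : M →ₗ[SRing K n] P) (hi : Function.Injective i)
    (hp : Function.Surjective p) (hpi : ∀ x, p (i x) = 0) (hex : ∀ m, p m = 0 → ∃ x, i x = m)
    (hN : ∀ e x, x ∈ 𝓝 e ↔ i x ∈ 𝓜 e) (hMP : ∀ e, ∀ m ∈ 𝓜 e, p m ∈ 𝓟 e)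
    (hP : ∀ e, ∀ x ∈ 𝓟 e, ∃ m ∈ 𝓜 e, p m = x)
    (hM : ∀ e d, ∀ m ∈ 𝓜 e, ∀ s : SRing K n, s.IsHomogeneous d → s • m ∈ 𝓜 (e + d))
    (h1 : LinearUpTo (K := K) (n := n) r N 𝓝) (h2 : LinearUpTo (K := K) (n := n) r P 𝓟) :
    LinearUpTo (K := K) (n := n) r M 𝓜 := by
  induction r generalizing N M P with
  | zero => trivial
  | succ r ih =>
    obtain ⟨a, φ, φs, φm, φl, hφ⟩ := h1
    obtain ⟨b, ψ, ψs, ψm, ψl, hψ⟩ := h2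
    have hlift : ∀ l, ∃ m ∈ 𝓜 0, p m = ψ (Finsupp.single l 1) := fun l =>
      hP 0 _ (ψm 0 _ (single_mem_homVec b l))
    choose m hm hpm using hlift
    set χ := Finsupp.linearCombination (SRing K n) m with hχ
    have hpχ : ∀ w, p (χ w) = ψ w := by
      have : p.comp χ = ψ := by
        ext l
        simp [hχ, hpm]
      intro w
      rw [← this]
      rfl
    have hχm : ∀ e, ∀ w ∈ homVec K n b e, χ w ∈ 𝓜 e := fun e w hw =>
      map_mem_of_mem_homVec hM χ (fun l => by simpa [hχ] using hm l) hw
    obtain ⟨ε, hε⟩ := exists_equiv_prod_homVec (K := K) (n := n) a b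
    set Φ := ((i.comp φ).coprod χ).comp ε.toLinearMap with hΦ
    have Φv : ∀ w, Φ w = i (φ (ε w).1) + χ (ε w).2 := fun w => by simp [hΦ]
    have lift : ∀ e, ∀ w ∈ homVec K n b e, ∀ m ∈ 𝓜 e, p m = ψ w →
        ∃ w' ∈ homVec K n a e, i (φ w') + χ w = m := by
      intro e w hw m hm hpmw
      obtain ⟨x, hx⟩ := hex (m - χ w) (by rw [map_sub, hpχ, hpmw, sub_self])
      obtain ⟨w', hw', rfl⟩ := φl e x ((hN e x).2 (hx ▸ sub_mem hm (hχm e w hw)))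
      exact ⟨w', hw', by rw [hx, sub_add_cancel]⟩
    have lift' : ∀ w, ∀ m, p m = ψ w → ∃ w', i (φ w') + χ w = m := by
      intro w m hpmw
      obtain ⟨x, hx⟩ := hex (m - χ w) (by rw [map_sub, hpχ, hpmw, sub_self])
      obtain ⟨w', rfl⟩ := φs x
      exact ⟨w', by rw [hx, sub_add_cancel]⟩
    refine ⟨a + b, Φ, ?_, ?_, ?_, ?_⟩
    · intro m
      obtain ⟨w, hw⟩ := ψs (p m)
      obtain ⟨w', hw'⟩ := lift' w m hw.symm
      exact ⟨ε.symm (w', w), by rw [Φv]; simpa using hw'⟩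
    · intro e w hw
      obtain ⟨h1, h2⟩ := (hε e w).1 hw
      rw [Φv]
      exact add_mem ((hN e _).1 (φm e _ h1)) (hχm e _ h2)
    · intro e m hm
      obtain ⟨w, hw, hwm⟩ := ψl e (p m) (hMP e m hm)
      obtain ⟨w', hw', h⟩ := lift e w hw m hm hwm.symm
      refine ⟨ε.symm (w', w), (hε e _).2 (by simpa using ⟨hw', hw⟩), ?_⟩
      rw [Φv]; simpa using h
    · have pK : ∀ w ∈ LinearMap.ker Φ, ψ (ε w).2 = 0 := by
        intro w hw
        have := congrArg p ((Φv w).symm.trans hw)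
        rwa [map_add, hpi, zero_add, hpχ, map_zero] at this
      let i' : LinearMap.ker φ →ₗ[SRing K n] LinearMap.ker Φ :=
        (ε.symm.toLinearMap.comp ((LinearMap.inl _ _ _).comp (LinearMap.ker φ).subtype)).codRestrict
          _ (fun w => by
            have : φ w.1 = 0 := w.2
            rw [LinearMap.mem_ker, Φv]; simp [this])
      let p' : LinearMap.ker Φ →ₗ[SRing K n] LinearMap.ker ψ :=
        ((LinearMap.snd _ _ _).comp (ε.toLinearMap.comp (LinearMap.ker Φ).subtype)).codRestrict
          _ (fun w => pK w.1 w.2)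
      have hi' : ∀ w, ε (i' w).1 = (w.1, 0) := fun w => by simp [i']
      have hp' : ∀ w, (p' w).1 = (ε w.1).2 := fun w => rfl
      refine ih i' p' ?_ ?_ ?_ ?_ ?_ ?_ ?_ ?_ hφ hψ
      · intro w w' h
        have := congrArg (fun v => (ε v.1).1) h
        simp only [hi'] at this
        exact Subtype.ext this
      · intro w
        obtain ⟨w', hw'⟩ := lift' w.1 0 (by rw [map_zero]; exact w.2.symm)
        exact ⟨⟨ε.symm (w', w.1), by rw [LinearMap.mem_ker, Φv]; simpa using hw'⟩,
          Subtype.ext (by rw [hp']; simp)⟩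
      · intro w
        exact Subtype.ext (by rw [hp', hi']; rfl)
      · intro w hw
        have h2 : (ε w.1).2 = 0 := by rw [← hp', hw]; rfl
        have h1 : φ (ε w.1).1 = 0 := by
          have := (Φv w.1).symm.trans w.2
          rw [h2, map_zero, add_zero] at this
          exact hi (this.trans (map_zero i).symm)
        refine ⟨⟨_, h1⟩, Subtype.ext (ε.injective ?_)⟩
        rw [hi']
        exact Prod.ext rfl h2.symm
      · intro e w
        change w.1 ∈ homVec K n a (e + 1) ↔ (i' w).1 ∈ homVec K n (a + b) (e + 1)
        rw [hε, hi']
        exact ⟨fun h => ⟨h, zero_mem _⟩, fun h => h.1⟩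
      · intro e w hw
        exact ((hε _ _).1 hw).2
      · intro e w hw
        obtain ⟨w', hw', h⟩ := lift (e + 1) w.1 hw 0 (zero_mem _) (by rw [map_zero]; exact w.2.symm)
        refine ⟨⟨ε.symm (w', w.1), by rw [LinearMap.mem_ker, Φv]; simpa using h⟩, ?_,
          Subtype.ext (by rw [hp']; simp)⟩
        exact (hε _ _).2 (by simpa using ⟨hw', hw⟩)
      · intro e d w hw s hs
        have := smul_mem_homVec (K := K) hw hs
        rw [add_right_comm] at this
        exact this

end Linear

section Ideals

variable {K : Type} [Field K] {n : ℕ}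

lemma homogeneousComponent_mul_of_isHomogeneous {D : ℕ} {q : SRing K n} (hq : q.IsHomogeneous D)
    (e : ℕ) (p : SRing K n) :
    homogeneousComponent (D + e) (p * q) = homogeneousComponent e p * q := by
  induction p using MvPolynomial.induction_on' with
  | monomial u c =>
    have h : (monomial u c : SRing K n).IsHomogeneous u.degree := isHomogeneous_monomial c rfl
    rw [homogeneousComponent_of_mem h, homogeneousComponent_of_mem (h.mul hq), add_comm D e]
    simp only [add_left_inj]
    split_ifs <;> simp
  | add p p' hp hp' => rw [add_mul, map_add, map_add, hp, hp', add_mul]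

/-- The homogeneous component of degree `e` of a vector. -/
def vecComponent {t : ℕ} (e : ℕ) (w : Fin t →₀ SRing K n) : Fin t →₀ SRing K n :=
  w.mapRange (homogeneousComponent e) (map_zero _)

lemma vecComponent_mem {t : ℕ} (e : ℕ) (w : Fin t →₀ SRing K n) :
    vecComponent e w ∈ homVec K n t e := fun l => by
  simpa [vecComponent] using homogeneousComponent_isHomogeneous e (w l)

lemma map_vecComponent {t D : ℕ} (φ : (Fin t →₀ SRing K n) →ₗ[SRing K n] SRing K n)
    (hφ : ∀ l, (φ (Finsupp.single l 1)).IsHomogeneous D) (e : ℕ) (w : Fin t →₀ SRing K n) :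
    φ (vecComponent e w) = homogeneousComponent (D + e) (φ w) := by
  rw [apply_eq_sum φ, apply_eq_sum φ w, map_sum]
  refine Finset.sum_congr rfl fun l _ => ?_
  rw [smul_eq_mul, smul_eq_mul, homogeneousComponent_mul_of_isHomogeneous (hφ l)]
  simp [vecComponent]

/-- The elements of an ideal that are homogeneous of degree `D + e`. -/
def idealPiece (J : Ideal (SRing K n)) (D e : ℕ) : AddSubgroup J :=
  (homogeneousSubmodule (Fin n) K (D + e)).toAddSubgroup.comap J.subtype.toAddMonoidHom

lemma mem_idealPiece {J : Ideal (SRing K n)} {D e : ℕ} {f : J} :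
    f ∈ idealPiece J D e ↔ f.1.IsHomogeneous (D + e) := Iff.rfl

/-- The ideal `J` has a `D`-linear resolution. -/
def HasLinearRes (J : Ideal (SRing K n)) (D : ℕ) : Prop :=
  ∀ r, LinearUpTo (K := K) (n := n) r J (idealPiece J D)

lemma hasLinearRes_bot (D : ℕ) : HasLinearRes (⊥ : Ideal (SRing K n)) D :=
  fun r => linearUpTo_of_subsingleton r _ _

lemma LinearUpTo.prod (r : ℕ) {N P : Type} [AddCommGroup N] [Module (SRing K n) N]
    [AddCommGroup P] [Module (SRing K n) P] {𝓝 : ℕ → AddSubgroup N} {𝓟 : ℕ → AddSubgroup P}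
    (hN : ∀ e d, ∀ m ∈ 𝓝 e, ∀ s : SRing K n, s.IsHomogeneous d → s • m ∈ 𝓝 (e + d))
    (hP : ∀ e d, ∀ m ∈ 𝓟 e, ∀ s : SRing K n, s.IsHomogeneous d → s • m ∈ 𝓟 (e + d))
    (h1 : LinearUpTo (K := K) (n := n) r N 𝓝) (h2 : LinearUpTo (K := K) (n := n) r P 𝓟) :
    LinearUpTo (K := K) (n := n) r (N × P) (fun e => (𝓝 e).prod (𝓟 e)) := by
  refine h1.extension r (LinearMap.inl _ _ _) (LinearMap.snd _ _ _) LinearMap.inl_injective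
    LinearMap.snd_surjective (fun x => rfl) ?_ ?_ ?_ ?_ ?_ h2
  · rintro ⟨a, b⟩ h
    exact ⟨a, Prod.ext rfl (Eq.symm h)⟩
  · intro e x
    exact ⟨fun h => ⟨h, zero_mem _⟩, fun h => h.1⟩
  · exact fun e m hm => hm.2
  · exact fun e x hx => ⟨(0, x), ⟨zero_mem _, hx⟩, rfl⟩
  · exact fun e d m hm s hs => ⟨hN e d _ hm.1 s hs, hP e d _ hm.2 s hs⟩

lemma HasLinearRes.top : HasLinearRes (⊤ : Ideal (SRing K n)) 0 := by
  intro r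
  cases r with
  | zero => trivial
  | succ r =>
    let φ : (Fin 1 →₀ SRing K n) →ₗ[SRing K n] (⊤ : Ideal (SRing K n)) :=
      (Finsupp.lapply 0).codRestrict _ fun _ => trivial
    have hφ : ∀ w, (φ w).1 = w 0 := fun w => rfl
    have hs : ∀ f : (⊤ : Ideal (SRing K n)), φ (Finsupp.single 0 f.1) = f := fun f =>
      Subtype.ext (by rw [hφ]; simp)
    refine ⟨1, φ, fun f => ⟨_, hs f⟩, ?_, ?_, ?_⟩
    · intro e w hw
      rw [mem_idealPiece, hφ, zero_add]
      exact hw 0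
    · intro e f hf
      refine ⟨_, fun l => ?_, hs f⟩
      rw [Subsingleton.elim l 0]
      rw [mem_idealPiece, zero_add] at hf
      simpa using hf
    · have : Subsingleton (LinearMap.ker φ) := by
        refine (Submodule.subsingleton_iff_eq_bot).2 (LinearMap.ker_eq_bot.2 fun w w' h =>
          Finsupp.ext fun l => ?_)
        rw [Subsingleton.elim l 0]
        exact congrArg Subtype.val h
      exact linearUpTo_of_subsingleton _ _ _

/-- If `C ⊆ D` have linear resolutions and `z` is a nonzerodivisor modulo `C`, then `C + zD` has
a linear resolution. -/
lemma HasLinearRes.sup_mul {C D : Ideal (SRing K n)} {z : Fin n} {d : ℕ}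
    (hC : HasLinearRes C (d + 1)) (hD : HasLinearRes D d) (hCD : C ≤ D)
    (hz : ∀ f, X z * f ∈ C → f ∈ C) : HasLinearRes (C ⊔ Ideal.span {X z} * D) (d + 1) := by
  intro r
  cases r with
  | zero => trivial
  | succ r =>
    obtain ⟨a, φ, φs, φm, φl, hφ⟩ := hC (r + 1)
    obtain ⟨b, ψ, ψs, ψm, ψl, hψ⟩ := hD (r + 1)
    obtain ⟨ε, hε⟩ := exists_equiv_prod_homVec (K := K) (n := n) a b
    let Φ₀ : (Fin (a + b) →₀ SRing K n) →ₗ[SRing K n] SRing K n :=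
      ((C.subtype.comp φ).coprod ((X z : SRing K n) • D.subtype.comp ψ)).comp ε.toLinearMap
    have Φ₀v : ∀ w, Φ₀ w = (φ (ε w).1).1 + X z * (ψ (ε w).2).1 := fun w => by simp [Φ₀]
    have Φm : ∀ w, Φ₀ w ∈ C ⊔ Ideal.span {X z} * D := by
      intro w
      rw [Φ₀v]
      exact Submodule.add_mem_sup (φ _).2
        (Ideal.mul_mem_mul (Ideal.mem_span_singleton_self _) (ψ _).2)
    have Φ₀h : ∀ e, ∀ w ∈ homVec K n (a + b) e, (Φ₀ w).IsHomogeneous (d + 1 + e) := by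
      intro e w hw
      obtain ⟨h1, h2⟩ := (hε e w).1 hw
      rw [Φ₀v]
      refine (φm e _ h1).add ?_
      have := (isHomogeneous_X K z).mul (ψm e _ h2)
      rwa [← add_assoc, add_comm 1 d] at this
    let Φ := Φ₀.codRestrict (C ⊔ Ideal.span {X z} * D) Φm
    have Φs : Function.Surjective Φ := by
      rintro ⟨f, hf⟩
      obtain ⟨c, hc, g, hg, rfl⟩ := Submodule.mem_sup.1 hf
      obtain ⟨g, hg', rfl⟩ := Ideal.mem_span_singleton_mul.1 hg
      obtain ⟨w1, h1⟩ := φs ⟨c, hc⟩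
      obtain ⟨w2, h2⟩ := ψs ⟨g, hg'⟩
      refine ⟨ε.symm (w1, w2), Subtype.ext ?_⟩
      change Φ₀ _ = _
      rw [Φ₀v]
      simp [h1, h2]
    refine ⟨a + b, Φ, Φs, Φ₀h, ?_, ?_⟩
    · intro e f hf
      obtain ⟨w, rfl⟩ := Φs f
      refine ⟨vecComponent e w, vecComponent_mem e w, Subtype.ext ?_⟩
      change Φ₀ _ = Φ₀ w
      rw [map_vecComponent Φ₀ (fun l => Φ₀h 0 _ (single_mem_homVec _ l)) e w]
      exact homogeneousComponent_eq_self hf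
    · have hK : ∀ w ∈ LinearMap.ker Φ, X z * (ψ (ε w).2).1 = - (φ (ε w).1).1 := by
        intro w hw
        have : Φ₀ w = 0 := congrArg Subtype.val hw
        rw [Φ₀v, add_comm] at this
        exact eq_neg_of_add_eq_zero_left this
      let i : LinearMap.ker φ × LinearMap.ker ψ →ₗ[SRing K n] LinearMap.ker Φ :=
        (ε.symm.toLinearMap.comp ((LinearMap.ker φ).subtype.prodMap
          (LinearMap.ker ψ).subtype)).codRestrict _ (fun w => by
            have h1 : φ w.1.1 = 0 := w.1.2
            have h2 : ψ w.2.1 = 0 := w.2.2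
            refine Subtype.ext ?_
            change Φ₀ _ = 0
            rw [Φ₀v]
            simp [h1, h2])
      have hi : ∀ w, ε (i w).1 = (w.1.1, w.2.1) := fun w =>
        ε.apply_symm_apply (w.1.1, w.2.1)
      let p : LinearMap.ker Φ →ₗ[SRing K n] C :=
        ((D.subtype.comp (ψ.comp (LinearMap.snd _ _ _))).comp
          (ε.toLinearMap.comp (LinearMap.ker Φ).subtype)).codRestrict C (fun w => by
            refine hz _ ?_
            change X z * (ψ (ε w.1).2).1 ∈ C
            rw [hK w.1 w.2]
            exact neg_mem (φ _).2)
      have hp : ∀ w, (p w).1 = (ψ (ε w.1).2).1 := fun w => rfl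
      have key : ∀ w1 w2, (φ w1).1 = - (X z * (ψ w2).1) →
          ∃ w : LinearMap.ker Φ, ε w.1 = (w1, w2) := by
        intro w1 w2 h
        refine ⟨⟨ε.symm (w1, w2), Subtype.ext ?_⟩, by simp⟩
        change Φ₀ _ = 0
        rw [Φ₀v]
        simp [h]
      refine LinearUpTo.extension r i p ?_ ?_ ?_ ?_ ?_ ?_ ?_ ?_
        (LinearUpTo.prod r ?_ ?_ hφ hψ) (hC r)
      · intro w w' h
        have := congrArg (fun v => ε v.1) h
        simp only [hi, Prod.mk.injEq] at this
        exact Prod.ext (Subtype.ext this.1) (Subtype.ext this.2)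
      · intro c
        obtain ⟨w2, h2⟩ := ψs ⟨c.1, hCD c.2⟩
        obtain ⟨w1, h1⟩ := φs ⟨- (X z * c.1), neg_mem (C.mul_mem_left _ c.2)⟩
        obtain ⟨w, hw⟩ := key w1 w2 (by rw [h1, h2])
        exact ⟨w, Subtype.ext (by rw [hp, hw, h2])⟩
      · intro w
        have h2 : ψ w.2.1 = 0 := w.2.2
        exact Subtype.ext (by rw [hp, hi, h2]; rfl)
      · intro w hw
        have h2 : (ψ (ε w.1).2).1 = 0 := by rw [← hp, hw]; rfl
        have h1 := hK w.1 w.2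
        rw [h2, mul_zero, eq_comm, neg_eq_zero] at h1
        refine ⟨(⟨_, Subtype.ext h1⟩, ⟨_, Subtype.ext h2⟩), Subtype.ext (ε.injective ?_)⟩
        rw [hi]
      · intro e w
        change w.1.1 ∈ homVec K n a (e + 1) ∧ w.2.1 ∈ homVec K n b (e + 1) ↔
          (i w).1 ∈ homVec K n (a + b) (e + 1)
        rw [hε, hi]
      · intro e w hw
        have := ψm _ _ ((hε _ _).1 hw).2
        rw [mem_idealPiece] at this ⊢
        rw [hp]
        rwa [add_assoc, add_comm 1 e]
      · intro e c hc
        rw [mem_idealPiece] at hc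
        obtain ⟨w2, hw2, h2⟩ := ψl (e + 1) ⟨c.1, hCD c.2⟩ (by
          rw [mem_idealPiece]
          rwa [add_comm e 1, ← add_assoc])
        obtain ⟨w1, hw1, h1⟩ := φl (e + 1) ⟨- (X z * c.1), neg_mem (C.mul_mem_left _ c.2)⟩ (by
          rw [mem_idealPiece]
          have := (isHomogeneous_X K z).mul hc
          rw [add_comm 1, add_assoc] at this
          exact this.neg)
        obtain ⟨w, hw⟩ := key w1 w2 (by rw [h1, h2])
        refine ⟨w, ?_, Subtype.ext (by rw [hp, hw, h2])⟩
        have : (ε w.1).1 ∈ homVec K n a (e + 1) ∧ (ε w.1).2 ∈ homVec K n b (e + 1) := by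
          rw [hw]
          exact ⟨hw1, hw2⟩
        exact (hε _ _).2 this
      · intro e d w hw s hs
        have := smul_mem_homVec (K := K) hw hs
        rw [add_right_comm] at this
        exact this
      · intro e d w hw s hs
        have := smul_mem_homVec (K := K) hw hs
        rw [add_right_comm] at this
        exact this
      · intro e d w hw s hs
        have := smul_mem_homVec (K := K) hw hs
        rw [add_right_comm] at this
        exact this

lemma HasLinearRes.span_X_mul {D : Ideal (SRing K n)} {d : ℕ} (hD : HasLinearRes D d)
    (z : Fin n) : HasLinearRes (Ideal.span {X z} * D) (d + 1) := by
  have := (hasLinearRes_bot (d + 1)).sup_mul (z := z) hD bot_le fun f hf => by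
    simpa using hf
  rwa [bot_sup_eq] at this

/-- The ideal `C` is generated by monomials in which the variable `z` does not occur. -/
def AvoidsVar (z : Fin n) (C : Ideal (SRing K n)) : Prop :=
  ∃ s : Set (Fin n →₀ ℕ), (∀ m ∈ s, m z = 0) ∧
    C = Ideal.span ((fun m => (monomial m (1 : K) : SRing K n)) '' s)

lemma AvoidsVar.mem_of_X_mul_mem {z : Fin n} {C : Ideal (SRing K n)} (h : AvoidsVar z C)
    (f : SRing K n) (hf : X z * f ∈ C) : f ∈ C := by
  obtain ⟨s, hs, rfl⟩ := h
  rw [mem_ideal_span_monomial_image] at hf ⊢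
  intro m hm
  obtain ⟨u, hu, hle⟩ := hf (Finsupp.single z 1 + m) (by
    rw [mem_support_iff, coeff_X_mul]
    exact mem_support_iff.1 hm)
  refine ⟨u, hu, fun j => ?_⟩
  by_cases hj : z = j
  · subst hj
    simp [hs u hu]
  · simpa [Finsupp.single_apply, hj] using hle j

lemma span_monomial_mul_span_monomial (s t : Set (Fin n →₀ ℕ)) :
    Ideal.span ((fun m => (monomial m (1 : K) : SRing K n)) '' s) *
      Ideal.span ((fun m => (monomial m (1 : K) : SRing K n)) '' t) =
    Ideal.span ((fun m => (monomial m (1 : K) : SRing K n)) '' Set.image2 (· + ·) s t) := by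
  rw [Ideal.span_mul_span', ← Set.image2_mul]
  congr 1
  ext p
  simp only [Set.mem_image2, Set.mem_image]
  constructor
  · rintro ⟨_, ⟨a, ha, rfl⟩, _, ⟨b, hb, rfl⟩, rfl⟩
    exact ⟨a + b, ⟨a, ha, b, hb, rfl⟩, by simp [monomial_mul]⟩
  · rintro ⟨_, ⟨a, ha, b, hb, rfl⟩, rfl⟩
    exact ⟨_, ⟨a, ha, rfl⟩, _, ⟨b, hb, rfl⟩, by simp [monomial_mul]⟩

lemma AvoidsVar.mul {z : Fin n} {C D : Ideal (SRing K n)} (hC : AvoidsVar z C)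
    (hD : AvoidsVar z D) : AvoidsVar z (C * D) := by
  obtain ⟨s, hs, rfl⟩ := hC
  obtain ⟨t, ht, rfl⟩ := hD
  refine ⟨Set.image2 (· + ·) s t, ?_, span_monomial_mul_span_monomial s t⟩
  rintro _ ⟨a, ha, b, hb, rfl⟩
  simp [hs a ha, ht b hb]

lemma avoidsVar_top (z : Fin n) : AvoidsVar z (⊤ : Ideal (SRing K n)) :=
  ⟨{0}, by simp, by simp⟩

lemma AvoidsVar.pow {z : Fin n} {C : Ideal (SRing K n)} (hC : AvoidsVar z C) (k : ℕ) :
    AvoidsVar z (C ^ k) := by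
  induction k with
  | zero => simpa using avoidsVar_top z
  | succ k ih => rw [pow_succ]; exact ih.mul hC

/-- The ideal generated by a set of variables. -/
def varIdeal (K : Type) [Field K] {n : ℕ} (A : Finset (Fin n)) : Ideal (SRing K n) :=
  Ideal.span (X '' (A : Set (Fin n)))

lemma avoidsVar_varIdeal {z : Fin n} {A : Finset (Fin n)} (h : z ∉ A) :
    AvoidsVar z (varIdeal K A) := by
  refine ⟨(fun a => Finsupp.single a 1) '' (A : Set (Fin n)), ?_, ?_⟩
  · rintro _ ⟨a, ha, rfl⟩
    have : a ≠ z := by rintro rfl; exact h ha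
    simp [this]
  · rw [Set.image_image]
    rfl

lemma varIdeal_insert (z : Fin n) (A : Finset (Fin n)) :
    varIdeal K (insert z A) = varIdeal K A + Ideal.span {X z} := by
  rw [varIdeal, Finset.coe_insert, Set.image_insert_eq, Ideal.span_insert, add_comm]
  rfl

lemma add_pow_succ_eq (a b : Ideal (SRing K n)) (p : ℕ) :
    (a + b) ^ (p + 1) = a ^ (p + 1) + b * (a + b) ^ p := by
  apply le_antisymm
  · induction p with
    | zero => simp
    | succ p ih =>
      calc (a + b) ^ (p + 2) = a * (a + b) ^ (p + 1) + b * (a + b) ^ (p + 1) := by ring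
        _ ≤ a * (a ^ (p + 1) + b * (a + b) ^ p) + b * (a + b) ^ (p + 1) :=
          add_le_add (Ideal.mul_mono_right ih) le_rfl
        _ = a ^ (p + 2) + (b * (a * (a + b) ^ p) + b * (a + b) ^ (p + 1)) := by ring
        _ ≤ a ^ (p + 2) + b * (a + b) ^ (p + 1) := by
          refine add_le_add le_rfl (sup_le ?_ le_rfl)
          rw [pow_succ' (a + b) p]
          exact Ideal.mul_mono_right (Ideal.mul_mono_left le_sup_left)
  · refine sup_le (Ideal.pow_right_mono le_sup_left _) ?_
    rw [pow_succ']
    exact Ideal.mul_mono_left le_sup_right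

lemma HasLinearRes.varIdeal_pow_mul {T : Ideal (SRing K n)} {d : ℕ} (hT : HasLinearRes T d)
    (A : Finset (Fin n)) (hA : ∀ z ∈ A, AvoidsVar z T) (p : ℕ) :
    HasLinearRes (varIdeal K A ^ p * T) (d + p) := by
  induction A using Finset.induction_on generalizing p with
  | empty =>
    cases p with
    | zero => simpa using hT
    | succ p => simpa [varIdeal] using hasLinearRes_bot _
  | insert z A hz ih =>
    have ih := ih fun y hy => hA y (Finset.mem_insert_of_mem hy)
    induction p with
    | zero => simpa using hT
    | succ p ihp =>
      have : varIdeal K (insert z A) ^ (p + 1) * T =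
          varIdeal K A ^ (p + 1) * T ⊔
            Ideal.span {X z} * (varIdeal K (insert z A) ^ p * T) := by
        rw [varIdeal_insert, add_pow_succ_eq, add_mul, mul_assoc]
        rfl
      rw [this]
      refine (ih (p + 1)).sup_mul ihp (Ideal.mul_mono_left ?_)
        (((avoidsVar_varIdeal hz).pow _).mul (hA z (Finset.mem_insert_self _ _))).mem_of_X_mul_mem
      rw [pow_succ]
      refine Ideal.mul_le_left.trans (Ideal.pow_right_mono ?_ _)
      rw [varIdeal_insert]
      exact le_sup_left

lemma HasLinearRes.span_X_pow_mul {D : Ideal (SRing K n)} {d : ℕ} (hD : HasLinearRes D d)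
    (z : Fin n) (k : ℕ) : HasLinearRes (Ideal.span {X z} ^ k * D) (d + k) := by
  induction k with
  | zero => simpa using hD
  | succ k ih =>
    rw [pow_succ', mul_assoc]
    exact ih.span_X_mul z

/-- All powers of the edge ideal of a double star, with centres `x` and `y`, have linear
resolutions. -/
lemma hasLinearRes_doubleStar_pow {x y : Fin n} {A B : Finset (Fin n)} (hxy : x ≠ y)
    (hxA : x ∉ A) (hxB : x ∉ B) (hyA : y ∈ A) (hAB : Disjoint A B) {I : Ideal (SRing K n)}
    (hI : I = Ideal.span {X y} * varIdeal K B + Ideal.span {X x} * varIdeal K A) (m j : ℕ) :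
    HasLinearRes (varIdeal K A ^ j * I ^ m) (j + 2 * m) := by
  induction m generalizing j with
  | zero => simpa using HasLinearRes.top.varIdeal_pow_mul A (fun z _ => avoidsVar_top z) j
  | succ m ih =>
    set c := Ideal.span {X y} * varIdeal K B with hc
    have h1 : varIdeal K A ^ j * I ^ (m + 1) =
        varIdeal K A ^ j * c ^ (m + 1) ⊔
          Ideal.span {X x} * (varIdeal K A ^ (j + 1) * I ^ m) := by
      rw [hI, add_pow_succ_eq, mul_add, pow_succ (varIdeal K A) j]
      congr 1
      ring
    have hcA : c ≤ varIdeal K A := by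
      refine Ideal.mul_le_left.trans ((Ideal.span_singleton_le_iff_mem _).2 ?_)
      exact Ideal.subset_span ⟨y, hyA, rfl⟩
    have hlin : HasLinearRes (varIdeal K A ^ j * c ^ (m + 1)) (j + 1 + 2 * m + 1) := by
      have hB : HasLinearRes (varIdeal K B ^ (m + 1) * ⊤) (0 + (m + 1)) :=
        HasLinearRes.top.varIdeal_pow_mul B (fun z _ => avoidsVar_top z) (m + 1)
      have := ((hB.varIdeal_pow_mul A (fun z hz =>
        ((avoidsVar_varIdeal (Finset.disjoint_left.1 hAB hz)).pow _).mul (avoidsVar_top z))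
        j).span_X_pow_mul y (m + 1))
      rw [← Ideal.one_eq_top, mul_one] at this
      convert this using 1
      · rw [hc, mul_pow]; ring
      · ring
    have hav : AvoidsVar x (varIdeal K A ^ j * c ^ (m + 1)) := by
      refine ((avoidsVar_varIdeal hxA).pow _).mul (AvoidsVar.pow ?_ _)
      refine AvoidsVar.mul ?_ (avoidsVar_varIdeal hxB)
      have := avoidsVar_varIdeal (K := K) (z := x) (A := {y}) (by simpa using hxy)
      simpa [varIdeal] using this
    rw [h1]
    have := hlin.sup_mul (ih (j + 1)) ?_ hav.mem_of_X_mul_mem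
    · convert this using 1
      ring
    · have hcI : c ≤ I := by rw [hI]; exact le_sup_left
      calc varIdeal K A ^ j * c ^ (m + 1)
          = varIdeal K A ^ j * (c * c ^ m) := by rw [pow_succ' c m]
        _ ≤ varIdeal K A ^ j * (varIdeal K A * I ^ m) :=
          Ideal.mul_mono_right (Ideal.mul_mono hcA (Ideal.pow_right_mono hcI m))
        _ = varIdeal K A ^ (j + 1) * I ^ m := by
          rw [pow_succ (varIdeal K A) j, mul_assoc]

end Ideals

section Betti

variable {K : Type} [Field K] {n : ℕ}

/-- A module with `r` linear steps has an honest sequence of free modules with linear maps that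
is exact in the first positions. -/
lemma LinearUpTo.exists_complex (r : ℕ) {M : Type} [AddCommGroup M] [Module (SRing K n) M]
    {𝓜 : ℕ → AddSubgroup M} (h : LinearUpTo (K := K) (n := n) r M 𝓜) :
    ∃ (s : ℕ → ℕ) (aug : (Fin (s 0) →₀ SRing K n) →ₗ[SRing K n] M)
      (diff : ∀ i, (Fin (s (i + 1)) →₀ SRing K n) →ₗ[SRing K n] (Fin (s i) →₀ SRing K n)),
      (∀ l, aug (Finsupp.single l 1) ∈ 𝓜 0) ∧
      (∀ i l, diff i (Finsupp.single l 1) ∈ homVec K n (s i) 1) ∧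
      (0 < r → Function.Surjective aug) ∧
      (1 < r → LinearMap.range (diff 0) = LinearMap.ker aug) ∧
      (∀ i, i + 2 < r → LinearMap.range (diff (i + 1)) = LinearMap.ker (diff i)) := by
  induction r generalizing M with
  | zero =>
    refine ⟨fun _ => 0, 0, fun _ => 0, fun l => l.elim0, fun i l => l.elim0, ?_, ?_, ?_⟩ <;>
    intros <;> omega
  | succ r ih =>
    obtain ⟨t, φ, φs, φm, φl, h⟩ := h
    obtain ⟨s, aug, diff, h1, h2, h3, h4, h5⟩ := ih h
    refine ⟨fun i => Nat.casesOn i t s, φ, fun i => match i with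
      | 0 => (LinearMap.ker φ).subtype.comp aug
      | i + 1 => diff i, fun l => φm 0 _ (single_mem_homVec t l), ?_, fun _ => φs, ?_, ?_⟩
    · rintro (_ | i) l
      · exact h1 l
      · exact h2 i l
    · intro hr
      change LinearMap.range ((LinearMap.ker φ).subtype.comp aug) = LinearMap.ker φ
      rw [LinearMap.range_comp, LinearMap.range_eq_top.2 (h3 (by omega)), Submodule.map_top,
        Submodule.range_subtype]
    · rintro (_ | i) hr
      · change LinearMap.range (diff 0) = LinearMap.ker ((LinearMap.ker φ).subtype.comp aug)
        rw [LinearMap.ker_comp_of_ker_eq_bot _ (Submodule.ker_subtype _)]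
        exact h4 (by omega)
      · exact h5 i (by omega)

lemma gradedBetti_eq_zero {I : Ideal (SRing K n)} {i j : ℕ}
    (R : GradedPartialRes I ((i : ℕ∞) + 1)) (h : ∀ k, R.dg i k ≠ j) : gradedBetti I i j = 0 := by
  refine le_antisymm (iInf_le_of_le R ?_) bot_le
  rw [Finset.filter_false_of_mem fun k _ => h k]
  simp

lemma HasLinearRes.stepsLinear {J : Ideal (SRing K n)} {D : ℕ} (h : HasLinearRes J D) (r : ℕ) :
    stepsLinear J D r := by
  intro i _ j hj
  obtain ⟨s, aug, diff, h1, h2, h3, h4, h5⟩ := (h (i + 2)).exists_complex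
  refine gradedBetti_eq_zero
    { s := s
      dg := fun i _ => D + i
      aug := J.subtype.comp aug
      diff := diff
      aug_hom := h1
      diff_hom := fun i k l => Or.inr ⟨1, h2 i k l, by omega⟩
      aug_range := ?_
      exact_zero := fun _ => ?_
      exact_succ := fun i' hi' => ?_ } (fun k => ?_)
  · rw [LinearMap.range_comp, LinearMap.range_eq_top.2 (h3 (by omega)), Submodule.map_top,
      Submodule.range_subtype]
  · rw [LinearMap.ker_comp_of_ker_eq_bot _ (Submodule.ker_subtype _)]
    exact h4 (by omega)
  · refine h5 i' ?_
    have : i' + 1 < i + 1 := by exact_mod_cast hi'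
    omega
  · change D + i ≠ i + j
    omega

/-- The kernel of a graded map from a free module is generated by finitely many homogeneous
vectors. -/
lemma exists_homogeneous_generators_ker {t D : ℕ}
    (φ : (Fin t →₀ SRing K n) →ₗ[SRing K n] SRing K n)
    (hφ : ∀ l, (φ (Finsupp.single l 1)).IsHomogeneous D) :
    ∃ (m : ℕ) (w : Fin m → (Fin t →₀ SRing K n)) (e : Fin m → ℕ),
      (∀ i, w i ∈ homVec K n t (e i)) ∧
      LinearMap.range (Finsupp.linearCombination (SRing K n) w) = LinearMap.ker φ := by
  set H : Set (Fin t →₀ SRing K n) := {w | φ w = 0 ∧ ∃ e, w ∈ homVec K n t e} with hH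
  have hspan : Submodule.span (SRing K n) H = LinearMap.ker φ := by
    apply le_antisymm
    · exact Submodule.span_le.2 fun w hw => hw.1
    · intro w hw
      have hsum : w = ∑ e ∈ Finset.range ((Finset.univ.sup fun l => (w l).totalDegree) + 1),
          vecComponent e w := by
        ext1 l
        simp only [vecComponent, Finsupp.finsetSum_apply, Finsupp.mapRange_apply]
        conv_lhs => rw [← sum_homogeneousComponent (w l)]
        refine Finset.sum_subset (Finset.range_mono (Nat.succ_le_succ
          (Finset.le_sup (f := fun l => (w l).totalDegree) (Finset.mem_univ l)))) fun e _ he => ?_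
        exact homogeneousComponent_eq_zero _ _ (by simpa using he)
      rw [hsum]
      refine sum_mem fun e _ => Submodule.subset_span ⟨?_, e, vecComponent_mem e w⟩
      rw [map_vecComponent φ hφ, hw, map_zero]
  obtain ⟨F, hF, hFs⟩ := (Submodule.fg_span_iff_fg_span_finset_subset H).1
    (IsNoetherian.noetherian (Submodule.span (SRing K n) H))
  have hmem : ∀ i : Fin F.card, ∃ e, (F.equivFin.symm i : Fin t →₀ SRing K n) ∈ homVec K n t e :=
    fun i => (hF (F.equivFin.symm i).2).2
  choose e he using hmem
  refine ⟨F.card, fun i => F.equivFin.symm i, e, he, ?_⟩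
  rw [Finsupp.range_linearCombination, ← hspan, hFs]
  congr 1
  ext w
  simp only [Set.mem_range, Finset.mem_coe]
  constructor
  · rintro ⟨i, rfl⟩
    exact (F.equivFin.symm i).2
  · intro hw
    exact ⟨F.equivFin ⟨w, hw⟩, by simp⟩

lemma stepsLinear_zero {J : Ideal (SRing K n)} {D : ℕ} {T : Set (SRing K n)} (hT : T.Finite)
    (hJ : J = Ideal.span T) (hD : ∀ f ∈ T, f.IsHomogeneous D) : stepsLinear J D 0 := by
  intro i hi j hj
  obtain rfl : i = 0 := by omega
  lift T to Finset (SRing K n) using hT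
  set φ : (Fin T.card →₀ SRing K n) →ₗ[SRing K n] SRing K n :=
    Finsupp.linearCombination (SRing K n) (fun i => (T.equivFin.symm i : SRing K n)) with hφ
  have hφh : ∀ l, (φ (Finsupp.single l 1)).IsHomogeneous D := fun l => by
    simpa [hφ] using hD _ (T.equivFin.symm l).2
  obtain ⟨m, w, e, he, hw⟩ := exists_homogeneous_generators_ker φ hφh
  refine gradedBetti_eq_zero
    { s := fun i => match i with
        | 0 => T.card
        | 1 => m
        | _ + 2 => 0
      dg := fun i => match i with
        | 0 => fun _ => D
        | 1 => fun l => D + e l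
        | _ + 2 => fun _ => 0
      aug := φ
      diff := fun i => match i with
        | 0 => Finsupp.linearCombination (SRing K n) w
        | _ + 1 => 0
      aug_hom := hφh
      diff_hom := ?_
      aug_range := ?_
      exact_zero := fun _ => hw
      exact_succ := fun i' hi' => ?_ } (fun k => ?_)
  · rintro (_ | i) k l
    · refine Or.inr ⟨e k, ?_, rfl⟩
      change ((Finsupp.linearCombination (SRing K n) w) (Finsupp.single k 1) l).IsHomogeneous _
      simpa using he k l
    · exact Or.inl rfl
  · rw [hφ, Finsupp.range_linearCombination, hJ, Ideal.span]
    congr 1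
    ext f
    simp only [Set.mem_range, Finset.mem_coe]
    constructor
    · rintro ⟨i, rfl⟩
      exact (T.equivFin.symm i).2
    · intro hf
      exact ⟨T.equivFin ⟨f, hf⟩, by simp⟩
  · exfalso
    have : i' + 1 < 0 + 1 := by exact_mod_cast hi'
    omega
  · change D ≠ 0 + j
    omega

lemma coeff_add_mul_eq {u t : Fin n →₀ ℕ} {f : SRing K n}
    (hf : ∀ m ∈ f.support, m ≤ u + t → u ≤ m) (p : SRing K n) :
    coeff (u + t) (p * f) = coeff t (p * (f.divMonomial u)) := by
  have h0 : coeff (u + t) (p * (f.modMonomial u)) = 0 := by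
    rw [coeff_mul]
    refine Finset.sum_eq_zero fun x hx => ?_
    rw [Finset.HasAntidiagonal.mem_antidiagonal] at hx
    by_cases hu : u ≤ x.2
    · rw [coeff_modMonomial_of_le _ hu, mul_zero]
    · rw [coeff_modMonomial_of_not_le _ hu]
      by_cases hs : x.2 ∈ f.support
      · exact absurd (hf _ hs (hx ▸ le_add_self)) hu
      · rw [notMem_support_iff.1 hs, mul_zero]
  conv_lhs => rw [← divMonomial_add_modMonomial f u]
  rw [mul_add, coeff_add, h0, add_zero, mul_left_comm, coeff_monomial_mul, one_mul]

lemma le_single_add_single {c d : Fin n} (hcd : c ≠ d) {y : Fin n →₀ ℕ}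
    (hy : y ≤ Finsupp.single c 1 + Finsupp.single d 1) :
    y = 0 ∨ y = Finsupp.single c 1 ∨ y = Finsupp.single d 1 ∨
      y = Finsupp.single c 1 + Finsupp.single d 1 := by
  have hc : y c ≤ 1 := by simpa [hcd] using hy c
  have hd : y d ≤ 1 := by simpa [hcd.symm] using hy d
  have ho : ∀ i, i ≠ c → i ≠ d → y i = 0 := fun i h1 h2 => by
    simpa [Finsupp.single_apply, h1.symm, h2.symm] using hy i
  have ext : ∀ x : Fin n →₀ ℕ, x c = y c → x d = y d → (∀ i, i ≠ c → i ≠ d → x i = 0) → y = x := by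
    intro x h1 h2 h3
    ext i
    by_cases hic : i = c
    · rw [hic, h1]
    by_cases hid : i = d
    · rw [hid, h2]
    rw [ho i hic hid, h3 i hic hid]
  have hc' : y c = 0 ∨ y c = 1 := by omega
  have hd' : y d = 0 ∨ y d = 1 := by omega
  have os : ∀ i, i ≠ c → i ≠ d → (Finsupp.single c 1 : Fin n →₀ ℕ) i = 0 ∧
      (Finsupp.single d 1 : Fin n →₀ ℕ) i = 0 := fun i h1 h2 => by
    simp [h1.symm, h2.symm]
  rcases hc' with h1 | h1 <;> rcases hd' with h2 | h2
  · exact Or.inl (ext _ (by simp [h1]) (by simp [h2]) fun i _ _ => rfl)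
  · exact Or.inr (Or.inr (Or.inl (ext _ (by simp [h1, hcd]) (by simp [h2])
      fun i a b => (os i a b).2)))
  · exact Or.inr (Or.inl (ext _ (by simp [h1]) (by simp [h2, hcd.symm])
      fun i a b => (os i a b).1))
  · exact Or.inr (Or.inr (Or.inr (ext _ (by simp [h1, hcd]) (by simp [h2, hcd.symm])
      fun i a b => by simp [os i a b])))

/-- If `u` is the only generator dividing `u x_c` or `u x_d`, and the least common multiple
`u x_c x_d` of `u` and another generator `v` is `v x_a x_b`, then there is a minimal quadratic
first syzygy. -/
lemma gradedBetti_one_ne_zero {J : Ideal (SRing K n)} {T : Set (Fin n →₀ ℕ)} {D : ℕ}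
    (hJ : J = Ideal.span ((fun m => (monomial m (1 : K) : SRing K n)) '' T))
    {u v : Fin n →₀ ℕ} (hu : u ∈ T) (hv : v ∈ T) (huD : u.degree = D) {a b c d : Fin n}
    (hcd : c ≠ d) (hac : a ≠ c) (had : a ≠ d)
    (huc : ∀ m ∈ T, m ≤ u + Finsupp.single c 1 → u = m)
    (hud : ∀ m ∈ T, m ≤ u + Finsupp.single d 1 → u = m)
    (huv : u + (Finsupp.single c 1 + Finsupp.single d 1) =
      v + (Finsupp.single a 1 + Finsupp.single b 1)) :
    gradedBetti J 1 (D + 2) ≠ 0 := by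
  rw [gradedBetti, Ne, ENat.iInf_eq_zero]
  rintro ⟨R, hR⟩
  have hR : ∀ k, R.dg 1 k ≠ D + 2 := by
    have := Finset.card_eq_zero.1 (by exact_mod_cast hR)
    intro k hk
    have hk' := (Finset.filter_eq_empty_iff.1 this) (Finset.mem_univ k)
    exact hk' hk
  set f := fun l => R.aug (Finsupp.single l 1) with hf
  have hmemJ : ∀ w, R.aug w ∈ Ideal.span ((fun m => (monomial m (1 : K) : SRing K n)) '' T) :=
    fun w => hJ.le (R.aug_range.le ⟨w, rfl⟩)
  have hsupp : ∀ l, ∀ m ∈ (f l).support, ∃ s ∈ T, s ≤ m := fun l => by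
    have := hmemJ (Finsupp.single l 1)
    rw [mem_ideal_span_monomial_image] at this
    exact this
  set q : (Fin (R.s 0) →₀ SRing K n) →ₗ[SRing K n] SRing K n :=
    Finsupp.linearCombination (SRing K n) (fun l => (f l).divMonomial u) with hq
  have hqs : ∀ w, q w = ∑ l, w l * ((f l).divMonomial u) := fun w => by
    rw [apply_eq_sum q]
    simp [hq]
  have hqaug : ∀ t, (∀ m ∈ T, m ≤ u + t → u = m) → ∀ w,
      coeff t (q w) = coeff (u + t) (R.aug w) := by
    intro t ht w
    rw [hqs, apply_eq_sum R.aug w, coeff_sum, coeff_sum]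
    refine Finset.sum_congr rfl fun l _ => ?_
    rw [smul_eq_mul, coeff_add_mul_eq]
    intro m hm hle
    obtain ⟨s, hs, hsm⟩ := hsupp l m hm
    exact (ht s hs (hsm.trans hle)) ▸ hsm
  have hu0 : ∀ m ∈ T, m ≤ u + 0 → u = m := fun m hm hle =>
    huc m hm (hle.trans (by simp))
  set cd : Fin n →₀ ℕ := Finsupp.single c 1 + Finsupp.single d 1 with hcd'
  have hdiff : ∀ l, coeff cd (q (R.diff 0 (Finsupp.single l 1))) = 0 := by
    intro l
    rw [hqs, coeff_sum]
    refine Finset.sum_eq_zero fun m _ => ?_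
    rcases R.diff_hom 0 l m with h | ⟨μ, hμ, hdeg⟩
    · rw [h, zero_mul, coeff_zero]
    · rw [coeff_mul]
      refine Finset.sum_eq_zero fun x hx => ?_
      rw [Finset.HasAntidiagonal.mem_antidiagonal] at hx
      rw [coeff_divMonomial]
      by_contra hne
      have h1 : x.1.degree = μ := by
        rw [Finsupp.degree_eq_weight_one]
        exact hμ (left_ne_zero_of_mul hne)
      have h2 : (u + x.2).degree = R.dg 0 m := by
        rw [Finsupp.degree_eq_weight_one]
        exact R.aug_hom m (right_ne_zero_of_mul hne)
      have h3 : x.1.degree + x.2.degree = 2 := by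
        rw [← map_add, hx, hcd', map_add]
        simp
      rw [map_add, huD] at h2
      apply hR l
      change R.dg 0 m + μ = R.dg 1 l at hdeg
      omega
  have hker : ∀ w, R.aug w = 0 → coeff cd (q w) = 0 → ∀ h : SRing K n,
      coeff cd (q (h • w)) = 0 := by
    intro w hw hw' h
    rw [map_smul, smul_eq_mul, coeff_mul]
    refine Finset.sum_eq_zero fun x hx => ?_
    rw [Finset.HasAntidiagonal.mem_antidiagonal] at hx
    suffices coeff x.2 (q w) = 0 by rw [this, mul_zero]
    have hle : x.2 ≤ cd := hx ▸ le_add_self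
    rcases le_single_add_single hcd hle with h | h | h | h <;> rw [h]
    · rw [hqaug 0 hu0, hw, coeff_zero]
    · rw [hqaug _ huc, hw, coeff_zero]
    · rw [hqaug _ hud, hw, coeff_zero]
    · exact hw'
  have hgen : ∀ m ∈ T, ∃ g, R.aug g = monomial m 1 := fun m hm => by
    have : (monomial m (1 : K) : SRing K n) ∈ LinearMap.range R.aug := by
      rw [R.aug_range]
      exact hJ.ge (Ideal.subset_span ⟨m, hm, rfl⟩)
    exact this
  obtain ⟨gu, hgu⟩ := hgen u hu
  obtain ⟨gv, hgv⟩ := hgen v hv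
  set z := (monomial cd (1 : K) : SRing K n) • gu -
    (monomial (Finsupp.single a 1 + Finsupp.single b 1) (1 : K) : SRing K n) • gv with hz
  have hexact := R.exact_zero (by norm_num)
  have hzk : z ∈ LinearMap.ker R.aug := by
    rw [LinearMap.mem_ker, hz, map_sub, map_smul, map_smul, hgu, hgv, smul_eq_mul, smul_eq_mul,
      monomial_mul, monomial_mul, add_comm cd, huv, add_comm v, sub_self]
  have hz1 : coeff cd (q z) = 1 := by
    rw [hz, map_sub, map_smul, map_smul, coeff_sub, smul_eq_mul, smul_eq_mul,
      coeff_monomial_mul', coeff_monomial_mul', if_pos le_rfl, if_neg, tsub_self, hqaug 0 hu0,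
      hgu]
    · simp
    · intro h
      have := h a
      simp [hcd', hac, had] at this
  rw [← hexact] at hzk
  obtain ⟨h, hh⟩ := hzk
  have : coeff cd (q z) = 0 := by
    rw [← hh, apply_eq_sum (R.diff 0), map_sum, coeff_sum]
    refine Finset.sum_eq_zero fun l _ => hker _ ?_ (hdiff l) _
    have : R.diff 0 (Finsupp.single l 1) ∈ LinearMap.ker R.aug := by
      rw [← hexact]
      exact ⟨_, rfl⟩
    exact this
  rw [this] at hz1
  exact zero_ne_one hz1

end Betti

section Powers

variable {K : Type} [Field K] {n : ℕ}

/-- The exponent vectors of the generators of the `k`-th power of the edge ideal of `E`. -/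
def edgePowExps (E : Fin n → Fin n → Prop) : ℕ → Set (Fin n →₀ ℕ)
  | 0 => {0}
  | k + 1 => Set.image2 (· + ·) (edgePowExps E k)
      {e | ∃ i j, E i j ∧ e = Finsupp.single i 1 + Finsupp.single j 1}

lemma edgeIdeal_pow_eq_span (E : Fin n → Fin n → Prop) (k : ℕ) :
    edgeIdeal K E ^ k =
      Ideal.span ((fun m => (monomial m (1 : K) : SRing K n)) '' edgePowExps E k) := by
  induction k with
  | zero => simp [edgePowExps]
  | succ k ih =>
    have h1 : edgeIdeal K E = Ideal.span ((fun m => (monomial m (1 : K) : SRing K n)) ''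
        {e | ∃ i j, E i j ∧ e = Finsupp.single i 1 + Finsupp.single j 1}) := by
      rw [edgeIdeal]
      congr 1
      ext p
      constructor
      · rintro ⟨i, j, h, rfl⟩
        exact ⟨_, ⟨i, j, h, rfl⟩, by simp [X, monomial_mul]⟩
      · rintro ⟨_, ⟨i, j, h, rfl⟩, rfl⟩
        exact ⟨i, j, h, by simp [X, monomial_mul]⟩
    rw [pow_succ, ih, edgePowExps, ← span_monomial_mul_span_monomial, ← h1]

lemma finite_edgePowExps (E : Fin n → Fin n → Prop) (k : ℕ) : (edgePowExps E k).Finite := by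
  induction k with
  | zero => exact Set.finite_singleton 0
  | succ k ih =>
    refine ih.image2 _ ?_
    refine (Set.finite_range fun p : Fin n × Fin n =>
      (Finsupp.single p.1 1 + Finsupp.single p.2 1 : Fin n →₀ ℕ)).subset ?_
    rintro _ ⟨i, j, -, rfl⟩
    exact ⟨(i, j), rfl⟩

lemma degree_of_mem_edgePowExps {E : Fin n → Fin n → Prop} {k : ℕ} {m : Fin n →₀ ℕ}
    (hm : m ∈ edgePowExps E k) : m.degree = 2 * k := by
  induction k generalizing m with
  | zero =>
    rw [show m = 0 from hm]
    simp
  | succ k ih =>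
    obtain ⟨m', hm', _, ⟨i, j, -, rfl⟩, rfl⟩ := hm
    simp only [map_add, ih hm', Finsupp.degree_single]
    ring

lemma nsmul_mem_edgePowExps {E : Fin n → Fin n → Prop} {a b : Fin n} (h : E a b) (k : ℕ) :
    k • (Finsupp.single a 1 + Finsupp.single b 1) ∈ edgePowExps E k := by
  induction k with
  | zero => simp [edgePowExps]
  | succ k ih => exact ⟨_, ih, _, ⟨a, b, h, rfl⟩, (succ_nsmul _ _).symm⟩

/-- If `ab` is the only edge on the vertices `a, b, c`, then `(X a * X b) ^ k` is the only
generator of the `k`-th power dividing `(X a * X b) ^ k * X c`. -/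
lemma eq_nsmul_of_mem_edgePowExps_of_le {G : SimpleGraph (Fin n)} {a b c : Fin n}
    (hac : ¬ G.Adj a c) (hbc : ¬ G.Adj b c) {k : ℕ} {m : Fin n →₀ ℕ}
    (hm : m ∈ edgePowExps G.Adj k)
    (hle : m ≤ k • (Finsupp.single a 1 + Finsupp.single b 1) + Finsupp.single c 1) :
    k • (Finsupp.single a 1 + Finsupp.single b 1) = m := by
  induction k generalizing m with
  | zero =>
    rw [show m = 0 from hm, zero_nsmul]
  | succ k ih =>
    obtain ⟨m', hm', _, ⟨i, j, hij, rfl⟩, rfl⟩ := hm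
    have key : ∀ l, 0 < (m' + (Finsupp.single i 1 + Finsupp.single j 1) : Fin n →₀ ℕ) l →
        l = a ∨ l = b ∨ l = c := by
      intro l hl
      by_contra! hcon
      have h0 : (((k + 1) • (Finsupp.single a 1 + Finsupp.single b 1) +
          Finsupp.single c 1 : Fin n →₀ ℕ)) l = 0 := by
        simp [hcon.1, hcon.2.1, hcon.2.2]
      exact absurd (hle l) (by rw [h0]; exact not_le.2 hl)
    have hi := key i (by simp)
    have hj := key j (by simp)
    have he : (Finsupp.single i 1 + Finsupp.single j 1 : Fin n →₀ ℕ) =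
        Finsupp.single a 1 + Finsupp.single b 1 := by
      rcases hi with rfl | rfl | rfl <;> rcases hj with rfl | rfl | rfl
      all_goals first
        | rfl
        | exact add_comm _ _
        | exact absurd hij (G.loopless.irrefl _)
        | exact absurd hij hac
        | exact absurd hij.symm hac
        | exact absurd hij hbc
        | exact absurd hij.symm hbc
    simp only [he] at hle ⊢
    rw [succ_nsmul, ih hm']
    rwa [succ_nsmul, add_right_comm, add_le_add_iff_right] at hle

lemma stepsLinear.mono {J : Ideal (SRing K n)} {d r s : ℕ} (h : stepsLinear J d r)
    (hs : s ≤ r) : stepsLinear J d s := fun i hi => h i (hi.trans hs)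

lemma idealIndex_eq_top {J : Ideal (SRing K n)} {d : ℕ} (h : ∀ r, stepsLinear J d r) :
    idealIndex J d = ⊤ := by
  rw [idealIndex, ENat.eq_top_iff_forall_ge]
  intro m
  exact (le_self_add).trans (le_sSup ⟨m, rfl, h m⟩)

lemma idealIndex_eq_one {J : Ideal (SRing K n)} {d : ℕ} (h0 : stepsLinear J d 0)
    (h1 : ¬ stepsLinear J d 1) : idealIndex J d = 1 := by
  refine le_antisymm (sSup_le ?_) (le_sSup ⟨0, by simp, h0⟩)
  rintro _ ⟨r, rfl, hr⟩
  rcases Nat.eq_zero_or_pos r with rfl | hpos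
  · simp
  · exact absurd (hr.mono hpos) h1

/-- If a graph has a gap, then no positive power of its edge ideal is linearly related. -/
lemma idealIndex_edgeIdeal_pow_eq_one {G : SimpleGraph (Fin n)} {a b c d : Fin n}
    (hab : G.Adj a b) (hcd : G.Adj c d) (hac : ¬ G.Adj a c) (had : ¬ G.Adj a d)
    (hbc : ¬ G.Adj b c) (hbd : ¬ G.Adj b d) {k : ℕ} (hk : 0 < k) :
    idealIndex (edgeIdeal K G.Adj ^ k) (2 * k) = 1 := by
  have hspan := edgeIdeal_pow_eq_span (K := K) G.Adj k
  refine idealIndex_eq_one (stepsLinear_zero ((finite_edgePowExps G.Adj k).image _) hspan ?_) ?_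
  · rintro _ ⟨m, hm, rfl⟩
    exact isHomogeneous_monomial _ (degree_of_mem_edgePowExps hm)
  · intro h
    obtain ⟨k, rfl⟩ : ∃ l, k = l + 1 := ⟨k - 1, by omega⟩
    have h1 := h 1 le_rfl (2 * (k + 1) + 1) (Nat.lt_succ_self _)
    rw [show 1 + (2 * (k + 1) + 1) = 2 * (k + 1) + 2 by ring] at h1
    refine gradedBetti_one_ne_zero hspan (nsmul_mem_edgePowExps hab (k + 1))
      (v := k • (Finsupp.single a 1 + Finsupp.single b 1) +
        (Finsupp.single c 1 + Finsupp.single d 1))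
      ⟨_, nsmul_mem_edgePowExps hab k, _, ⟨c, d, hcd, rfl⟩, rfl⟩
      (degree_of_mem_edgePowExps (nsmul_mem_edgePowExps hab (k + 1)))
      (a := a) (b := b) (c := c) (d := d) hcd.ne ?_ ?_
      (fun m hm => eq_nsmul_of_mem_edgePowExps_of_le hac hbc hm)
      (fun m hm => eq_nsmul_of_mem_edgePowExps_of_le had hbd hm) ?_ h1
    · rintro rfl; exact had hcd
    · rintro rfl; exact hac hcd.symm
    · rw [succ_nsmul, add_right_comm]

end Powers

section Trees

variable {K : Type} [Field K] {n : ℕ}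

lemma SimpleGraph.IsAcyclic.not_adj_of_isPath {V : Type*} {G : SimpleGraph V}
    (hG : G.IsAcyclic) {u v : V} {p : G.Walk u v} (hp : p.IsPath) (hlen : 1 < p.length) :
    ¬ G.Adj u v := by
  intro h
  have := (hG.subsingleton_path u v).elim ⟨p, hp⟩ (SimpleGraph.Path.singleton h)
  have h1 := congrArg (fun q : G.Path u v => (q : G.Walk u v).length) this
  simp [SimpleGraph.Path.singleton] at h1
  omega

/-- In an acyclic graph without gaps, an edge with maximal degree sum meets every edge `cd` with
`c` adjacent to one of its ends. -/
lemma SimpleGraph.IsAcyclic.false_of_disjoint_edge {V : Type*} [Fintype V] [DecidableEq V]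
    {G : SimpleGraph V} [DecidableRel G.Adj] (hG : G.IsAcyclic)
    (hgap : ∀ a b c d, G.Adj a b → G.Adj c d →
      G.Adj a c ∨ G.Adj a d ∨ G.Adj b c ∨ G.Adj b d) {x y c d : V}
    (hmax : ∀ u v, G.Adj u v → G.degree u + G.degree v ≤ G.degree x + G.degree y)
    (hxy : G.Adj x y) (hcd : G.Adj c d) (hcx : c ≠ x) (hdx : d ≠ x) (hdy : d ≠ y)
    (hyc : G.Adj y c) : False := by
  have hxc : ¬ G.Adj x c :=
    hG.not_adj_of_isPath (p := .cons hxy (.cons hyc .nil))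
      (by simp [SimpleGraph.Walk.cons_isPath_iff, hxy.ne, hcx.symm, hyc.ne]) (by simp)
  have hxd : ¬ G.Adj x d :=
    hG.not_adj_of_isPath (p := .cons hxy (.cons hyc (.cons hcd .nil)))
      (by simp [SimpleGraph.Walk.cons_isPath_iff, hxy.ne, hcx.symm, hyc.ne, hdx.symm, hdy.symm,
        hcd.ne]) (by simp)
  have hx : G.neighborFinset x ⊆ {y} := by
    intro w hw
    rw [SimpleGraph.mem_neighborFinset] at hw
    rw [Finset.mem_singleton]
    by_contra hwy
    have hwc : w ≠ c := by rintro rfl; exact hxc hw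
    have hwd : w ≠ d := by rintro rfl; exact hxd hw
    rcases hgap x w c d hw hcd with h | h | h | h
    · exact hxc h
    · exact hxd h
    · exact hG.not_adj_of_isPath (p := .cons hw.symm (.cons hxy (.cons hyc .nil)))
        (by simp [SimpleGraph.Walk.cons_isPath_iff, hxy.ne, hcx.symm, hyc.ne, hw.ne', hwy, hwc])
        (by simp) h
    · exact hG.not_adj_of_isPath
        (p := .cons hw.symm (.cons hxy (.cons hyc (.cons hcd .nil))))
        (by simp [SimpleGraph.Walk.cons_isPath_iff, hxy.ne, hcx.symm, hyc.ne, hdx.symm,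
          hdy.symm, hcd.ne, hw.ne', hwy, hwc, hwd]) (by simp) h
  have hc : {y, d} ⊆ G.neighborFinset c := by
    intro w hw
    rw [SimpleGraph.mem_neighborFinset]
    rcases Finset.mem_insert.1 hw with rfl | hw
    · exact hyc.symm
    · rw [Finset.mem_singleton.1 hw]; exact hcd
  have h1 := Finset.card_le_card hx
  have h2 := Finset.card_le_card hc
  rw [Finset.card_pair hdy.symm, SimpleGraph.card_neighborFinset_eq_degree] at h2
  rw [Finset.card_singleton, SimpleGraph.card_neighborFinset_eq_degree] at h1
  have := hmax y c hyc
  omega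

lemma SimpleGraph.IsAcyclic.exists_dominating_edge {V : Type*} [Fintype V]
    {G : SimpleGraph V} (hG : G.IsAcyclic)
    (hgap : ∀ a b c d, G.Adj a b → G.Adj c d →
      G.Adj a c ∨ G.Adj a d ∨ G.Adj b c ∨ G.Adj b d) (hne : ∃ a b, G.Adj a b) :
    ∃ x y, G.Adj x y ∧ ∀ c d, G.Adj c d → c = x ∨ c = y ∨ d = x ∨ d = y := by
  classical
  obtain ⟨⟨x, y⟩, hxy, hmax⟩ := Finset.exists_max_image
    (Finset.univ.filter fun p : V × V => G.Adj p.1 p.2)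
    (fun p => G.degree p.1 + G.degree p.2) (by
      obtain ⟨a, b, h⟩ := hne
      exact ⟨(a, b), by simpa using h⟩)
  have hxy : G.Adj x y := by simpa using hxy
  have hmax : ∀ u v, G.Adj u v → G.degree u + G.degree v ≤ G.degree x + G.degree y :=
    fun u v h => hmax (u, v) (by simpa using h)
  have hmax' : ∀ u v, G.Adj u v → G.degree u + G.degree v ≤ G.degree y + G.degree x :=
    fun u v h => (hmax u v h).trans (add_comm _ _).le
  refine ⟨x, y, hxy, fun c d hcd => ?_⟩
  by_contra! hcon
  obtain ⟨hcx, hcy, hdx, hdy⟩ := hcon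
  rcases hgap x y c d hxy hcd with h | h | h | h
  · exact hG.false_of_disjoint_edge hgap hmax' hxy.symm hcd hcy hdy hdx h
  · exact hG.false_of_disjoint_edge hgap hmax' hxy.symm hcd.symm hdy hcy hcx h
  · exact hG.false_of_disjoint_edge hgap hmax hxy hcd hcx hdx hdy h
  · exact hG.false_of_disjoint_edge hgap hmax hxy hcd.symm hdx hcx hcy h

/-- Positive powers of the edge ideal of an acyclic graph without gaps have linear
resolutions. -/
lemma hasLinearRes_edgeIdeal_pow {G : SimpleGraph (Fin n)} (hG : G.IsAcyclic)
    (hgap : ∀ a b c d, G.Adj a b → G.Adj c d →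
      G.Adj a c ∨ G.Adj a d ∨ G.Adj b c ∨ G.Adj b d) {k : ℕ} (hk : 0 < k) :
    HasLinearRes (edgeIdeal K G.Adj ^ k) (2 * k) := by
  classical
  by_cases hne : ∃ a b, G.Adj a b
  · obtain ⟨x, y, hxy, hdom⟩ := hG.exists_dominating_edge hgap hne
    have hI : edgeIdeal K G.Adj =
        Ideal.span {X y} * varIdeal K ((G.neighborFinset y).erase x) +
          Ideal.span {X x} * varIdeal K (G.neighborFinset x) := by
      rw [varIdeal, varIdeal, Ideal.span_mul_span', Ideal.span_mul_span',
        Set.singleton_mul, Set.singleton_mul, Ideal.add_eq_sup]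
      refine le_antisymm (Ideal.span_le.2 ?_) (sup_le (Ideal.span_le.2 ?_) (Ideal.span_le.2 ?_))
      · have key : ∀ i j, G.Adj i j → i = x ∨ i = y → (X i * X j : SRing K n) ∈
            Ideal.span ((fun p => X y * p) ''
                (X '' (((G.neighborFinset y).erase x : Finset (Fin n)) : Set (Fin n)))) ⊔
              Ideal.span ((fun p => X x * p) ''
                (X '' ((G.neighborFinset x : Finset (Fin n)) : Set (Fin n)))) := by
          rintro i j hij (rfl | rfl)
          · exact Ideal.mem_sup_right (Ideal.subset_span ⟨_, ⟨j, by simpa using hij, rfl⟩, rfl⟩)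
          · by_cases hjx : j = x
            · subst hjx
              rw [mul_comm]
              exact Ideal.mem_sup_right
                (Ideal.subset_span ⟨_, ⟨i, by simpa using hij.symm, rfl⟩, rfl⟩)
            · exact Ideal.mem_sup_left
                (Ideal.subset_span ⟨_, ⟨j, by simp [hjx, hij], rfl⟩, rfl⟩)
        rintro _ ⟨i, j, hij, rfl⟩
        rcases hdom i j hij with h | h | h | h
        · exact key i j hij (.inl h)
        · exact key i j hij (.inr h)
        · rw [mul_comm]; exact key j i hij.symm (.inl h)
        · rw [mul_comm]; exact key j i hij.symm (.inr h)
      · rintro _ ⟨_, ⟨j, hj, rfl⟩, rfl⟩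
        exact Ideal.subset_span ⟨y, j, by simpa using Finset.mem_of_mem_erase hj, rfl⟩
      · rintro _ ⟨_, ⟨j, hj, rfl⟩, rfl⟩
        exact Ideal.subset_span ⟨x, j, by simpa using hj, rfl⟩
    have hdisj : Disjoint (G.neighborFinset x) ((G.neighborFinset y).erase x) := by
      rw [Finset.disjoint_left]
      intro z hzx hzy
      rw [SimpleGraph.mem_neighborFinset] at hzx
      rw [Finset.mem_erase, SimpleGraph.mem_neighborFinset] at hzy
      exact hG.not_adj_of_isPath (p := .cons hxy (.cons hzy.2 .nil))
        (by simp [SimpleGraph.Walk.cons_isPath_iff, hxy.ne, hzy.1.symm, hzy.2.ne]) (by simp) hzx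
    have := hasLinearRes_doubleStar_pow hxy.ne (by simp) (by simp) (by simpa using hxy) hdisj
      hI k 0
    simpa using this
  · have hI : edgeIdeal K G.Adj = ⊥ := by
      rw [edgeIdeal, Ideal.span_eq_bot]
      rintro _ ⟨i, j, h, -⟩
      exact absurd ⟨i, j, h⟩ hne
    rw [hI, ← Ideal.zero_eq_bot, zero_pow hk.ne', Ideal.zero_eq_bot]
    exact hasLinearRes_bot _

end Trees

/-- For the edge ideal `I` of a tree, every power `I^k` has index `1` or `∞`; if
`index(I) = ∞` then `index(I^k) = ∞` for all `k`, if `index(I) = 1` then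
`index(I^k) = 1` for all `k`, and no intermediate finite value of `index(I)` occurs. -/
theorem stmt5 (K : Type) [Field K] (n : ℕ) (G : SimpleGraph (Fin n)) (hG : G.IsTree)
    (I : Ideal (SRing K n)) (hI : I = edgeIdeal K G.Adj) :
    (∀ k : ℕ, 0 < k →
      idealIndex (I ^ k) (2*k) = 1 ∨ idealIndex (I ^ k) (2*k) = ⊤) ∧
    (idealIndex I 2 = ⊤ → ∀ k : ℕ, 0 < k → idealIndex (I ^ k) (2*k) = ⊤) ∧
    (idealIndex I 2 = 1 → ∀ k : ℕ, 0 < k → idealIndex (I ^ k) (2*k) = 1) ∧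
    (idealIndex I 2 = 1 ∨ idealIndex I 2 = ⊤) := by
  subst hI
  have hdich : (∀ k : ℕ, 0 < k → idealIndex (edgeIdeal K G.Adj ^ k) (2 * k) = 1) ∨
      (∀ k : ℕ, 0 < k → idealIndex (edgeIdeal K G.Adj ^ k) (2 * k) = ⊤) := by
    by_cases hgap : ∀ a b c d, G.Adj a b → G.Adj c d →
        G.Adj a c ∨ G.Adj a d ∨ G.Adj b c ∨ G.Adj b d
    · exact .inr fun k hk => idealIndex_eq_top fun r =>
        (hasLinearRes_edgeIdeal_pow hG.isAcyclic hgap hk).stepsLinear r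
    · push Not at hgap
      obtain ⟨a, b, c, d, hab, hcd, hac, had, hbc, hbd⟩ := hgap
      exact .inl fun k hk => idealIndex_edgeIdeal_pow_eq_one hab hcd hac had hbc hbd hk
  have h1 : ∀ t, (∀ k : ℕ, 0 < k → idealIndex (edgeIdeal K G.Adj ^ k) (2 * k) = t) →
      idealIndex (edgeIdeal K G.Adj) 2 = t := fun t h => by
    simpa using h 1 one_pos
  rcases hdich with h | h
  · refine ⟨fun k hk => .inl (h k hk), fun htop => ?_, fun _ => h, .inl (h1 1 h)⟩
    rw [h1 1 h] at htop
    exact absurd htop (by simp)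
  · refine ⟨fun k hk => .inr (h k hk), fun _ => h, fun hone => ?_, .inr (h1 ⊤ h)⟩
    rw [h1 ⊤ h] at hone
    exact absurd hone (by simp)

end
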